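/- For sorted sample points y_i^s = IF((i − 1/2)/N), i = 1,…,N, generated from a continuous strictly increasing CDF F with inverse IF, the empirical CDF F_N(y) = (1/N)·#{i : y_i^s ≤ y} satisfies |F_N(y) − F(y)| ≤ 1/N for all y ∈ ℝ. -/

import Mathlib

open Set Finset

/-- Deterministic lifting at the mid-quantiles `(i − 1/2)/N`: the empirical CDF of the
points `y_i^s = IF((i − 1/2)/N)`, `i = 1,…,N`, approximates the true CDF `F`
uniformly with error at most `1/N`. -/
theorem empirical_cdf_of_midquantiles_close
    (F : ℝ → ℝ) (hcont : Continuous F) (hmono : StrictMono F)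
    (hrange : ∀ x : ℝ, F x ∈ Ioo (0 : ℝ) 1)
    (IF : ℝ → ℝ) (hIF : ∀ q ∈ Ioo (0 : ℝ) 1, F (IF q) = q)
    (N : ℕ) (hN : 0 < N) :
    ∀ y : ℝ,
      |((Finset.range N).filter
            (fun i : ℕ => IF (((i : ℝ) + 1 / 2) / N) ≤ y)).card / (N : ℝ)
        - F y| ≤ 1 / N := by
  intro y
  obtain ⟨h0, h1⟩ := hrange y
  have hNr : (0 : ℝ) < N := by exact_mod_cast hN
  have hp : 0 < F y * N := mul_pos h0 hNr
  have hlt : F y * N < N := by nlinarith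
  have hnn : 0 ≤ F y * N + 1 / 2 := by linarith
  have hset : ((Finset.range N).filter
      (fun i : ℕ => IF (((i : ℝ) + 1 / 2) / N) ≤ y)) = Finset.range ⌊F y * N + 1 / 2⌋₊ := by
    ext i
    simp only [Finset.mem_filter, Finset.mem_range]
    have key : i < ⌊F y * N + 1 / 2⌋₊ ↔ (i : ℝ) + 1 / 2 ≤ F y * N := by
      rw [← Nat.succ_le_iff, Nat.le_floor_iff hnn]
      push_cast
      constructor <;> intro h <;> linarith
    have iff2 : i < N → (IF (((i : ℝ) + 1 / 2) / N) ≤ y ↔ (i : ℝ) + 1 / 2 ≤ F y * N) := by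
      intro hi
      have hi' : (i : ℝ) + 1 ≤ N := by exact_mod_cast hi
      have hq : ((i : ℝ) + 1 / 2) / N ∈ Ioo (0 : ℝ) 1 := by
        refine ⟨by positivity, ?_⟩
        rw [div_lt_one hNr]
        linarith
      rw [← hmono.le_iff_le, hIF _ hq, div_le_iff₀ hNr]
    rw [key]
    constructor
    · rintro ⟨hi, h⟩
      exact (iff2 hi).1 h
    · intro h
      have hi : i < N := by
        have : (i : ℝ) < N := by linarith
        exact_mod_cast this
      exact ⟨hi, (iff2 hi).2 h⟩
  rw [hset, Finset.card_range]
  have a1 := Nat.floor_le hnn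
  have a2 := Nat.lt_floor_add_one (F y * N + 1 / 2)
  have e : (⌊F y * N + 1 / 2⌋₊ : ℝ) / N - F y = ((⌊F y * N + 1 / 2⌋₊ : ℝ) - F y * N) / N := by
    field_simp
  rw [e, abs_div, abs_of_pos hNr]
  apply div_le_div_of_nonneg_right _ hNr.le
  rw [abs_le]
  constructor <;> linarith
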